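/- arXiv:2104.13784 — 2 statements merged into one kernel-verified Lean document; each statement's English description precedes it below -/
import Mathlib

section
/- For every integer K ≥ 1, the trace of F = F_K is a Casimir function of the Flaschka–Newell bracket: {Tr F, s_j}_{FN} = 0 for every j = 1, …, 2K+2, and {Tr F, λ}_{FN} = 0, identically on ℂ^{2K+2} × ℂ*. -/
noncomputable section

open Matrix Finset

/-- Partial derivative with respect to the Stokes coordinate `s_j`
(0-based index `j`, corresponding to the paper's `s_{j+1}`) of a function
of `(s, λ) ∈ ℂ^{2K+2} × ℂ`. -/
def pS (K : ℕ) (j : Fin (2*K+2)) (f : (Fin (2*K+2) → ℂ) → ℂ → ℂ)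
    (s : Fin (2*K+2) → ℂ) (lam : ℂ) : ℂ :=
  fderiv ℂ (fun t => f t lam) s (Pi.single j 1)

/-- Partial derivative with respect to `λ`. -/
def pL (K : ℕ) (f : (Fin (2*K+2) → ℂ) → ℂ → ℂ)
    (s : Fin (2*K+2) → ℂ) (lam : ℂ) : ℂ :=
  deriv (f s) lam

/-- The structure constant `{s_{j+1}, s_{l+1}}_{FN}` (0-based indices `j < l`):
`δ_{j+1,l} − δ_{j,0} δ_{l,2K+1} λ^{−2} + (−1)^{j+l+1} s_j s_l`
(which is the paper's `δ_{j,l−1} − δ_{j,1}δ_{l,2K+2} λ^{−2} + (−1)^{j−l+1} s_j s_l`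
in 1-based indexing). -/
def cSS (K : ℕ) (j l : Fin (2*K+2)) (s : Fin (2*K+2) → ℂ) (lam : ℂ) : ℂ :=
  (if (j:ℕ)+1 = (l:ℕ) then 1 else 0)
  - (if (j:ℕ) = 0 ∧ (l:ℕ) = 2*K+1 then (lam^2)⁻¹ else 0)
  + (-1:ℂ)^((j:ℕ)+(l:ℕ)+1) * s j * s l

/-- The structure constant `{s_{j+1}, λ}_{FN} = (−1)^{j+1} s_{j+1} λ` (0-based `j`). -/
def cSL (K : ℕ) (j : Fin (2*K+2)) (s : Fin (2*K+2) → ℂ) (lam : ℂ) : ℂ :=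
  (-1:ℂ)^((j:ℕ)+1) * s j * lam

/-- The Flaschka–Newell bracket of two functions of `(s, λ)`:
`{f,g} = Σ_{j<l} {s_j,s_l}·(∂_j f ∂_l g − ∂_l f ∂_j g) + Σ_j {s_j,λ}·(∂_j f ∂_λ g − ∂_λ f ∂_j g)`. -/
def fnBr (K : ℕ) (f g : (Fin (2*K+2) → ℂ) → ℂ → ℂ)
    (s : Fin (2*K+2) → ℂ) (lam : ℂ) : ℂ :=
  (∑ j : Fin (2*K+2), ∑ l : Fin (2*K+2),
    if (j:ℕ) < (l:ℕ) then
      cSS K j l s lam *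
        (pS K j f s lam * pS K l g s lam - pS K l f s lam * pS K j g s lam)
    else 0)
  + ∑ j : Fin (2*K+2),
      cSL K j s lam * (pS K j f s lam * pL K g s lam - pL K f s lam * pS K j g s lam)

/-- Upper-triangular unipotent 2×2 matrix `[[1, a], [0, 1]]`. -/
def Umat (a : ℂ) : Matrix (Fin 2) (Fin 2) ℂ := !![1, a; 0, 1]

/-- Lower-triangular unipotent 2×2 matrix `[[1, 0], [a, 1]]`. -/
def Lmat (a : ℂ) : Matrix (Fin 2) (Fin 2) ℂ := !![1, 0; a, 1]

/-- The Pauli matrix `σ3`. -/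
def sigma3 : Matrix (Fin 2) (Fin 2) ℂ := !![1, 0; 0, -1]

/-- The matrix `σ₊`. -/
def sigmaP : Matrix (Fin 2) (Fin 2) ℂ := !![0, 1; 0, 0]

/-- The matrix `σ₋`. -/
def sigmaM : Matrix (Fin 2) (Fin 2) ℂ := !![0, 0; 1, 0]

/-- The matrix `F = F_K(s, λ) = [[1,s_1],[0,1]]·[[1,0],[s_2,1]] ⋯
[[1,s_{2K+1}],[0,1]]·[[1,0],[s_{2K+2},1]]·diag(λ, λ⁻¹)`
(here `s` is 0-based: `s i` is the paper's `s_{i+1}`). -/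
def Fmat (K : ℕ) (s : Fin (2*K+2) → ℂ) (lam : ℂ) : Matrix (Fin 2) (Fin 2) ℂ :=
  ((List.ofFn fun i : Fin (K+1) =>
      Umat (s ⟨2*(i:ℕ), by have := i.isLt; omega⟩) *
      Lmat (s ⟨2*(i:ℕ)+1, by have := i.isLt; omega⟩)).prod)
    * !![lam, 0; 0, lam⁻¹]

/-- alternating unipotent factor -/
def fS (j : ℕ) (a : ℂ) : Matrix (Fin 2) (Fin 2) ℂ := if Even j then Umat a else Lmat a

/-- its nilpotent direction -/
def fE (j : ℕ) : Matrix (Fin 2) (Fin 2) ℂ := if Even j then sigmaP else sigmaM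

/-- partial products -/
def fP (x : ℕ → ℂ) : ℕ → Matrix (Fin 2) (Fin 2) ℂ
  | 0 => 1
  | n+1 => fP x n * fS n (x n)

/-- inverse partial products -/
def fQ (x : ℕ → ℂ) : ℕ → Matrix (Fin 2) (Fin 2) ℂ
  | 0 => 1
  | n+1 => fS n (-x n) * fQ x n

/-- extension by zero -/
def fX (n : ℕ) (s : Fin n → ℂ) (i : ℕ) : ℂ := if h : i < n then s ⟨i, h⟩ else 0

/-- the diagonal matrix -/
def fLam (lam : ℂ) : Matrix (Fin 2) (Fin 2) ℂ := !![lam, 0; 0, lam⁻¹]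

/-- cyclic conjugates -/
def fG (x : ℕ → ℂ) (n : ℕ) (lam : ℂ) (j : ℕ) : Matrix (Fin 2) (Fin 2) ℂ :=
  fQ x j * (fP x n * fLam lam) * fP x j

/-- gradient components -/
def fD (x : ℕ → ℂ) (n : ℕ) (lam : ℂ) (j : ℕ) : ℂ :=
  if Even j then fG x n lam j 1 0 else fG x n lam j 0 1

/-- diagonal difference -/
def fH (x : ℕ → ℂ) (n : ℕ) (lam : ℂ) (j : ℕ) : ℂ :=
  fG x n lam j 0 0 - fG x n lam j 1 1

lemma fS_neg_mul (j : ℕ) (a : ℂ) : fS j (-a) * fS j a = 1 := by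
  unfold fS Umat Lmat
  split_ifs <;> ext i k <;> fin_cases i <;> fin_cases k <;> simp

lemma fS_mul_neg (j : ℕ) (a : ℂ) : fS j a * fS j (-a) = 1 := by
  simpa using fS_neg_mul j (-a)

lemma fE_mul_fS (j : ℕ) (a : ℂ) : fE j * fS j a = fE j := by
  unfold fS fE Umat Lmat sigmaP sigmaM
  split_ifs <;> ext i k <;> fin_cases i <;> fin_cases k <;> simp

lemma fS_add (j : ℕ) (a t : ℂ) : fS j (a + t) = fS j a + t • fE j := by
  unfold fS fE Umat Lmat sigmaP sigmaM
  split_ifs <;> ext i k <;> fin_cases i <;> fin_cases k <;> simp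

lemma fQ_mul_fP (x : ℕ → ℂ) (n : ℕ) : fQ x n * fP x n = 1 := by
  induction n with
  | zero => simp [fQ, fP]
  | succ n ih =>
    calc fQ x (n+1) * fP x (n+1) = fS n (-x n) * (fQ x n * fP x n) * fS n (x n) := by
          simp only [fQ, fP, Matrix.mul_assoc]
      _ = 1 := by rw [ih, Matrix.mul_one, fS_neg_mul]

lemma fP_congr (x y : ℕ → ℂ) (n : ℕ) (h : ∀ i < n, x i = y i) : fP x n = fP y n := by
  induction n with
  | zero => rfl
  | succ n ih => simp only [fP]; rw [ih (fun i hi => h i (by omega)), h n (by omega)]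

lemma fP_update (x y : ℕ → ℂ) (j : ℕ) (t : ℂ) (hj : y j = x j + t)
    (h : ∀ i, i ≠ j → y i = x i) (n : ℕ) (hn : j + 1 ≤ n) :
    fP y n = fP x n + t • (fP x j * fE j * fQ x j * fP x n) := by
  induction n, hn using Nat.le_induction with
  | base =>
    simp only [fP]
    rw [fP_congr y x j (fun i hi => h i (by omega)), hj, fS_add, Matrix.mul_add]
    congr 1
    rw [show fP x j * fE j * fQ x j * (fP x j * fS j (x j))
      = fP x j * fE j * (fQ x j * fP x j) * fS j (x j) by simp only [Matrix.mul_assoc],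
      fQ_mul_fP, Matrix.mul_one, Matrix.mul_assoc, fE_mul_fS, Matrix.mul_smul]
  | succ n hn ih =>
    simp only [fP]
    rw [ih, h n (by omega), Matrix.add_mul, Matrix.smul_mul]
    simp only [Matrix.mul_assoc]

lemma fD_eq (x : ℕ → ℂ) (n : ℕ) (lam : ℂ) (j : ℕ) :
    Matrix.trace (fP x j * fE j * fQ x j * fP x n * fLam lam) = fD x n lam j := by
  rw [show fP x j * fE j * fQ x j * fP x n * fLam lam
    = fP x j * (fE j * (fQ x j * (fP x n * fLam lam))) by simp only [Matrix.mul_assoc],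
    Matrix.trace_mul_comm]
  rw [show fE j * (fQ x j * (fP x n * fLam lam)) * fP x j = fE j * fG x n lam j by
    simp only [fG, Matrix.mul_assoc]]
  unfold fE fD sigmaP sigmaM
  split_ifs <;> simp [Matrix.trace_fin_two, Matrix.vecMul, dotProduct, Fin.sum_univ_two]

lemma fG_succ (x : ℕ → ℂ) (n : ℕ) (lam : ℂ) (j : ℕ) :
    fG x n lam (j+1) = fS j (-x j) * fG x n lam j * fS j (x j) := by
  simp only [fG, fP, fQ, Matrix.mul_assoc]

lemma fH_succ (x : ℕ → ℂ) (n : ℕ) (lam : ℂ) (j : ℕ) :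
    (-1:ℂ)^j * x j * fD x n lam j = (fH x n lam j - fH x n lam (j+1)) / 2 := by
  unfold fH fD
  rw [fG_succ]
  unfold fS Umat Lmat
  split_ifs with h
  · simp [Matrix.mul_apply, Matrix.vecMul, dotProduct, Fin.sum_univ_two, h.neg_one_pow]; ring
  · simp [Matrix.mul_apply, Matrix.vecMul, dotProduct, Fin.sum_univ_two, (Nat.not_even_iff_odd.1 h).neg_one_pow]; ring

/-- the entry of the `j`-th conjugate not equal to `fD j` -/
def fC (x : ℕ → ℂ) (n : ℕ) (lam : ℂ) (j : ℕ) : ℂ :=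
  if Even j then fG x n lam j 0 1 else fG x n lam j 1 0

lemma fC_succ (x : ℕ → ℂ) (n : ℕ) (lam : ℂ) (j : ℕ) :
    fC x n lam (j+1) = fD x n lam j := by
  unfold fC fD
  rw [fG_succ]
  unfold fS Umat Lmat
  by_cases h : Even j
  · simp [h, Nat.even_add_one, Matrix.mul_apply, Matrix.vecMul, dotProduct, Fin.sum_univ_two]
  · simp [h, Nat.even_add_one, Matrix.mul_apply, Matrix.vecMul, dotProduct, Fin.sum_univ_two]

lemma fD_succ (x : ℕ → ℂ) (n : ℕ) (lam : ℂ) (j : ℕ) :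
    fC x n lam j - fD x n lam (j+1)
      = -(-1:ℂ)^j * x j * ((fH x n lam j + fH x n lam (j+1)) / 2) := by
  unfold fC fD fH
  rw [fG_succ]
  unfold fS Umat Lmat
  by_cases h : Even j
  · simp [h, Nat.even_add_one, Matrix.mul_apply, Matrix.vecMul, dotProduct, Fin.sum_univ_two]; ring
  · simp [h, Nat.even_add_one, Matrix.mul_apply, Matrix.vecMul, dotProduct, Fin.sum_univ_two,
      (Nat.not_even_iff_odd.1 h).neg_one_pow]; ring

lemma fG_last (x : ℕ → ℂ) (n : ℕ) (lam : ℂ) : fG x n lam n = fLam lam * fP x n := by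
  simp only [fG]
  rw [← Matrix.mul_assoc, fQ_mul_fP, Matrix.one_mul]

lemma fG_zero (x : ℕ → ℂ) (n : ℕ) (lam : ℂ) : fG x n lam 0 = fP x n * fLam lam := by
  simp [fG, fP, fQ]

lemma fH_last (x : ℕ → ℂ) (n : ℕ) (lam : ℂ) : fH x n lam n = fH x n lam 0 := by
  unfold fH
  rw [fG_last, fG_zero]
  simp [fLam, Matrix.mul_apply, Fin.sum_univ_two]; ring

lemma fC_zero (x : ℕ → ℂ) (m : ℕ) (hm : Odd m) (lam : ℂ) (hl : lam ≠ 0) :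
    fC x (m+1) lam 0 = (lam^2)⁻¹ * fD x (m+1) lam m := by
  rw [← fC_succ]
  have : Even (m+1) := hm.add_one
  unfold fC
  rw [fG_last, fG_zero]
  simp [this, fLam, Matrix.mul_apply, Fin.sum_univ_two]; field_simp

lemma fD_last (x : ℕ → ℂ) (m : ℕ) (hm : Odd m) (lam : ℂ) (hl : lam ≠ 0) :
    fD x (m+1) lam (m+1) = (lam^2)⁻¹ * fD x (m+1) lam 0 := by
  have : Even (m+1) := hm.add_one
  unfold fD
  rw [fG_last, fG_zero]
  simp [this, fLam, Matrix.mul_apply, Fin.sum_univ_two]; field_simp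

lemma ofFn_eq_fP (x : ℕ → ℂ) (m : ℕ) :
    (List.ofFn fun i : Fin m => Umat (x (2*(i:ℕ))) * Lmat (x (2*(i:ℕ)+1))).prod
      = fP x (2*m) := by
  induction m with
  | zero => simp [fP]
  | succ m ih =>
    rw [List.ofFn_succ', List.concat_eq_append, List.prod_append]
    simp only [Fin.val_castSucc, Fin.val_last, ih, List.prod_singleton]
    rw [show 2*(m+1) = 2*m+1+1 by ring]
    simp [fP, fS, Matrix.mul_assoc, Nat.even_add_one]

lemma Fmat_eq (K : ℕ) (s : Fin (2*K+2) → ℂ) (lam : ℂ) :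
    Fmat K s lam = fP (fX (2*K+2) s) (2*K+2) * fLam lam := by
  unfold Fmat fLam
  rw [show fP (fX (2*K+2) s) (2*K+2) = fP (fX (2*K+2) s) (2*(K+1)) from rfl, ← ofFn_eq_fP]
  congr 3
  ext1 i
  have := i.isLt
  simp [fX, show 2*(i:ℕ) < 2*K+2 by omega, show 2*(i:ℕ)+1 < 2*K+2 by omega]

lemma fX_diff (n i : ℕ) : Differentiable ℂ (fun s : Fin n → ℂ => fX n s i) := by
  unfold fX
  split_ifs <;> fun_prop

lemma fP_diff (n m : ℕ) : ∀ a b, Differentiable ℂ (fun s : Fin n → ℂ => fP (fX n s) m a b) := by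
  induction m with
  | zero => intro a b; simp [fP]
  | succ m ih =>
    intro a b
    have h0 := ih a 0
    have h1 := ih a 1
    have hS : ∀ c, Differentiable ℂ (fun s : Fin n → ℂ => fS m (fX n s m) c b) := by
      intro c
      have := fX_diff n m
      unfold fS Umat Lmat
      split_ifs <;> fin_cases c <;> fin_cases b <;> simp <;> fun_prop
    have h2 := hS 0
    have h3 := hS 1
    simp only [fP, Matrix.mul_apply, Fin.sum_univ_two]
    fun_prop

lemma T_diff (K : ℕ) (lam : ℂ) :
    Differentiable ℂ (fun s : Fin (2*K+2) → ℂ => Matrix.trace (Fmat K s lam)) := by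
  simp only [Fmat_eq, Matrix.trace_fin_two, Matrix.mul_apply, Fin.sum_univ_two]
  have := fP_diff (2*K+2) (2*K+2)
  have h00 := this 0 0
  have h01 := this 0 1
  have h10 := this 1 0
  have h11 := this 1 1
  fun_prop

lemma pS_T (K : ℕ) (j : Fin (2*K+2)) (s : Fin (2*K+2) → ℂ) (lam : ℂ) :
    pS K j (fun t lm => Matrix.trace (Fmat K t lm)) s lam
      = fD (fX (2*K+2) s) (2*K+2) lam j := by
  unfold pS
  rw [← (T_diff K lam s).lineDeriv_eq_fderiv, lineDeriv]
  have key : ∀ t : ℂ, Matrix.trace (Fmat K (s + t • Pi.single j 1) lam)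
      = Matrix.trace (Fmat K s lam) + t * fD (fX (2*K+2) s) (2*K+2) lam j := by
    intro t
    rw [Fmat_eq, Fmat_eq, fP_update (fX (2*K+2) s) _ j t _ _ _ j.isLt, Matrix.add_mul,
      Matrix.trace_add, Matrix.smul_mul, Matrix.trace_smul, fD_eq, smul_eq_mul]
    · simp [fX]
    · intro i hi
      unfold fX
      split_ifs with h
      · have : (⟨i, h⟩ : Fin (2*K+2)) ≠ j := fun e => hi (by rw [← e])
        simp [this]
      · rfl
  simp only [key]
  simp

lemma pL_T (K : ℕ) (s : Fin (2*K+2) → ℂ) (lam : ℂ) (hl : lam ≠ 0) :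
    lam * pL K (fun t lm => Matrix.trace (Fmat K t lm)) s lam
      = fH (fX (2*K+2) s) (2*K+2) lam 0 := by
  unfold pL fH
  rw [fG_zero]
  simp only [Fmat_eq, Matrix.trace_fin_two, Matrix.mul_apply, Fin.sum_univ_two, fLam]
  generalize fP (fX (2*K+2) s) (2*K+2) = M
  have h : HasDerivAt (fun y : ℂ => M 0 0 * y + M 1 1 * y⁻¹)
      (M 0 0 * 1 + M 1 1 * (-(lam^2)⁻¹)) lam :=
    ((hasDerivAt_id lam).const_mul _).add ((hasDerivAt_inv hl).const_mul _)
  simp only [Matrix.of_apply, Matrix.cons_val', Matrix.cons_val_zero, Matrix.cons_val_one,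
    Matrix.cons_val_fin_one, mul_zero, add_zero, zero_add]
  rw [h.deriv]
  field_simp
  try ring

lemma tele (h : ℕ → ℂ) (l n : ℕ) (hn : l + 1 ≤ n) :
    ∑ j ∈ range n, ((if j < l then (1:ℂ) else 0) - (if l < j then 1 else 0))
      * ((h j - h (j+1)) / 2) = (h 0 - h l) / 2 - (h (l+1) - h n) / 2 := by
  induction n, hn using Nat.le_induction with
  | base =>
    rw [sum_range_succ]
    have : ∑ j ∈ range l, ((if j < l then (1:ℂ) else 0) - (if l < j then 1 else 0))
      * ((h j - h (j+1)) / 2) = ∑ j ∈ range l, (h j / 2 - h (j+1) / 2) := by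
      apply sum_congr rfl
      intro j hj
      have := mem_range.1 hj
      simp [this, show ¬ l < j by omega]; ring
    rw [this, sum_range_sub' (fun j => h j / 2)]
    simp; ring
  | succ n hn ih =>
    rw [sum_range_succ, ih]
    simp [show ¬ n < l by omega, show l < n by omega]; ring

lemma pS_coord (K : ℕ) (i j : Fin (2*K+2)) (s : Fin (2*K+2) → ℂ) (lam : ℂ) :
    pS K i (fun t _ => t j) s lam = if i = j then 1 else 0 := by
  unfold pS
  have : HasFDerivAt (fun t : Fin (2*K+2) → ℂ => t j)
    (ContinuousLinearMap.proj (R := ℂ) (φ := fun _ : Fin (2*K+2) => ℂ) j) s :=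
    hasFDerivAt_apply j s
  rw [this.fderiv]
  simp [Pi.single_apply, eq_comm]

lemma sum_ite_pt (n m : ℕ) (c : Prop) [Decidable c] (f : ℕ → ℂ) (hm : c → m < n) :
    ∑ j ∈ range n, (if j = m ∧ c then f j else 0) = if c then f m else 0 := by
  by_cases hc : c
  · simp [hc, hm hc]
  · simp [hc]

lemma sum_fin_of (n : ℕ) (g : Fin n → ℂ) (f : ℕ → ℂ) (h : ∀ j, g j = f j) :
    ∑ j, g j = ∑ j ∈ range n, f j := by
  rw [← Fin.sum_univ_eq_sum_range]
  exact sum_congr rfl (fun j _ => h j)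

/-- `Tr F` is a Casimir of the Flaschka–Newell bracket:
`{Tr F, s_j}_{FN} = 0` for all `j = 1, …, 2K+2` and `{Tr F, λ}_{FN} = 0`,
identically on `ℂ^{2K+2} × ℂ*`. -/
theorem fn_trace_casimir (K : ℕ) (hK : 1 ≤ K) (s : Fin (2*K+2) → ℂ) (lam : ℂ)
    (hlam : lam ≠ 0) :
    (∀ j : Fin (2*K+2),
      fnBr K (fun t lm => Matrix.trace (Fmat K t lm)) (fun t _ => t j) s lam = 0)
    ∧ fnBr K (fun t lm => Matrix.trace (Fmat K t lm)) (fun _ lm => lm) s lam = 0 := by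
  have hodd : Odd (2*K+1) := ⟨K, rfl⟩
  set x := fX (2*K+2) s with hx
  have hxs : ∀ j : Fin (2*K+2), s j = x j := by intro j; simp [hx, fX]
  constructor
  · intro l
    unfold fnBr
    simp only [pS_T, pS_coord]
    have hpl : pL K (fun t _ => t l) s lam = 0 := by simp [pL]
    rw [hpl]
    have hlt := l.isLt
    have e2 : ∑ j : Fin (2*K+2), cSL K j s lam * (fD x (2*K+2) lam j * 0
        - pL K (fun t lm => Matrix.trace (Fmat K t lm)) s lam * (if j = l then 1 else 0))
        = (-1:ℂ)^(l:ℕ) * x l * fH x (2*K+2) lam 0 := by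
      rw [← pL_T K s lam hlam]
      simp only [mul_zero, zero_sub, mul_ite, mul_one, mul_neg]
      simp [cSL, hxs, pow_succ]
      ring
    have e1 : ∀ c : Fin (2*K+2) → Fin (2*K+2) → ℂ, (∑ j : Fin (2*K+2), ∑ m : Fin (2*K+2),
        if (j:ℕ) < (m:ℕ) then c j m * (fD x (2*K+2) lam j * (if m = l then 1 else 0)
          - fD x (2*K+2) lam m * (if j = l then 1 else 0)) else 0)
        = ∑ j : Fin (2*K+2), ((if (j:ℕ) < (l:ℕ) then c j l else 0)
          - (if (l:ℕ) < (j:ℕ) then c l j else 0)) * fD x (2*K+2) lam j := by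
      intro c
      have : ∀ j m : Fin (2*K+2), (if (j:ℕ) < (m:ℕ) then
          c j m * (fD x (2*K+2) lam j * (if m = l then 1 else 0)
          - fD x (2*K+2) lam m * (if j = l then 1 else 0)) else 0)
          = (if m = l then (if (j:ℕ) < (m:ℕ) then c j m * fD x (2*K+2) lam j else 0) else 0)
          - (if j = l then (if (j:ℕ) < (m:ℕ) then c j m * fD x (2*K+2) lam m else 0) else 0) := by
        intro j m
        split_ifs <;> ring
      simp only [this, sum_sub_distrib, sub_mul]
      congr 1
      · simp [ite_mul]
      · rw [sum_comm]; simp [ite_mul]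
    rw [e1, e2]
    obtain ⟨f, hf⟩ : ∃ f : ℕ → ℂ, f = (fun j : ℕ => (if j = (l:ℕ) - 1 ∧ 0 < (l:ℕ) then fD x (2*K+2) lam j else 0)
          - (if j = (l:ℕ) + 1 ∧ (l:ℕ) < 2*K+1 then fD x (2*K+2) lam j else 0)
          - (if j = 0 ∧ (l:ℕ) = 2*K+1 then (lam^2)⁻¹ * fD x (2*K+2) lam j else 0)
          + (if j = 2*K+1 ∧ (l:ℕ) = 0 then (lam^2)⁻¹ * fD x (2*K+2) lam j else 0)
          - (-1:ℂ)^(l:ℕ) * x l * (((if j < (l:ℕ) then (1:ℂ) else 0)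
            - (if (l:ℕ) < j then 1 else 0)) *
             ((fH x (2*K+2) lam j - fH x (2*K+2) lam (j+1)) / 2))) := ⟨_, rfl⟩
    have e3 : ∀ j : Fin (2*K+2), ((if (j:ℕ) < (l:ℕ) then cSS K j l s lam else 0)
          - (if (l:ℕ) < (j:ℕ) then cSS K l j s lam else 0)) * fD x (2*K+2) lam j
        = f (j:ℕ) := by
      intro j
      have hj := j.isLt
      rw [hf]
      simp only [← fH_succ, cSS, hxs]
      generalize fD x (2*K+2) lam j = D
      generalize (j:ℕ) = j at *
      generalize (l:ℕ) = l at *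
      rcases lt_trichotomy j l with h | h | h
      · have a1 : (j + 1 = l) ↔ (j = l - 1 ∧ 0 < l) := by omega
        have a2 : ¬ (j = l + 1 ∧ l < 2*K+1) := by omega
        have a3 : ¬ (j = 2*K+1 ∧ l = 0) := by omega
        simp only [h, a1, a2, a3, not_lt.2 h.le, if_true, if_false]
        simp only [pow_add]
        split_ifs <;> ring
      · have a1 : ¬ (j = l - 1 ∧ 0 < l) := by omega
        have a2 : ¬ (j = l + 1 ∧ l < 2*K+1) := by omega
        have a3 : ¬ (j = 2*K+1 ∧ l = 0) := by omega
        have a4 : ¬ (j = 0 ∧ l = 2*K+1) := by omega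
        subst h
        simp only [a1, a2, a3, a4, lt_irrefl, if_false]
        ring
      · have a1 : (l + 1 = j) ↔ (j = l + 1 ∧ l < 2*K+1) := by omega
        have a2 : ¬ (j = l - 1 ∧ 0 < l) := by omega
        have a3 : ¬ (j = 0 ∧ l = 2*K+1) := by omega
        simp only [h, a1, a2, a3, not_lt.2 h.le, if_true, if_false, and_comm (a := l = 0)]
        simp only [pow_add]
        split_ifs <;> ring
    rw [sum_fin_of _ _ f e3, hf]
    simp only [sum_add_distrib, sum_sub_distrib]
    rw [← mul_sum, tele (fH x (2*K+2) lam) l (2*K+2) hlt, fH_last]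
    rw [sum_ite_pt _ _ _ _ (by omega), sum_ite_pt _ _ _ _ (by omega),
      sum_ite_pt _ _ _ (fun j => (lam^2)⁻¹ * fD x (2*K+2) lam j) (by omega),
      sum_ite_pt _ _ _ (fun j => (lam^2)⁻¹ * fD x (2*K+2) lam j) (by omega)]
    have A : (if 0 < (l:ℕ) then fD x (2*K+2) lam ((l:ℕ)-1) else 0)
        + (if (l:ℕ) = 0 then (lam^2)⁻¹ * fD x (2*K+2) lam (2*K+1) else 0)
        = fC x (2*K+2) lam l := by
      by_cases h : (l:ℕ) = 0
      · simp only [h, lt_irrefl, if_false, if_true, zero_add]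
        exact (fC_zero x (2*K+1) hodd lam hlam).symm
      · obtain ⟨m, hm⟩ := Nat.exists_eq_succ_of_ne_zero h
        rw [hm]
        simp [fC_succ]
    have B : (if (l:ℕ) < 2*K+1 then fD x (2*K+2) lam ((l:ℕ)+1) else 0)
        + (if (l:ℕ) = 2*K+1 then (lam^2)⁻¹ * fD x (2*K+2) lam 0 else 0)
        = fD x (2*K+2) lam ((l:ℕ)+1) := by
      by_cases h : (l:ℕ) = 2*K+1
      · simp only [h, lt_irrefl, if_false, if_true, zero_add]
        exact (fD_last x (2*K+1) hodd lam hlam).symm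
      · simp [h, show (l:ℕ) < 2*K+1 by omega]
    linear_combination A - B + fD_succ x (2*K+2) lam l
  · unfold fnBr
    have h0 : ∀ j, pS K j (fun _ lm => lm) s lam = 0 := by intro j; simp [pS]
    have h1 : pL K (fun _ lm => lm) s lam = 1 := by simp [pL]
    simp only [h0, h1, pS_T]
    obtain ⟨f, hf⟩ : ∃ f : ℕ → ℂ, f = (fun j : ℕ => fH x (2*K+2) lam (j+1) * (lam/2) - fH x (2*K+2) lam j * (lam/2)) := ⟨_, rfl⟩
    have e3 : ∀ j : Fin (2*K+2), cSL K j s lam * (fD x (2*K+2) lam j * 1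
        - pL K (fun t lm => Matrix.trace (Fmat K t lm)) s lam * 0)
        = f (j:ℕ) := by
      intro j
      simp only [cSL, hxs, hf]
      linear_combination (-lam) * fH_succ x (2*K+2) lam j
    rw [sum_fin_of _ _ f e3, hf, sum_range_sub (fun j => fH x (2*K+2) lam j * (lam/2)), fH_last]
    simp
end
end

section
/- For every integer K ≥ 1, the log-canonical bracket of the cluster parametrization satisfies {s_1, s_{2K+2}}_y = −λ^{−2} + s_1 s_{2K+2}, as an identity of rational functions of y on (ℂ*)^{2K}. -/
noncomputable section

open Finset

/-- The space of cluster variables `(y_1, …, y_{2K})`; we use 1-based indexing, so the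
vector has `2K+1` slots and slot `0` is a dummy unused coordinate. -/
abbrev YV (K : ℕ) := Fin (2*K+1) → ℂ

/-- Access `y_j` by its (1-based) natural-number index. -/
def yv (K : ℕ) (y : YV K) (j : ℕ) : ℂ := y ⟨j % (2*K+1), Nat.mod_lt _ (by omega)⟩

/-- Partial derivative with respect to `y_i`. -/
def pY (K : ℕ) (i : Fin (2*K+1)) (f : YV K → ℂ) (y : YV K) : ℂ :=
  fderiv ℂ f y (Pi.single i 1)

/-- The log-canonical bracket
`{f, g}_y = (1/4) Σ_{i=1}^{2K−1} y_i y_{i+1} (∂f/∂y_i ∂g/∂y_{i+1} − ∂f/∂y_{i+1} ∂g/∂y_i)`. -/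
def lcBr (K : ℕ) (f g : YV K → ℂ) (y : YV K) : ℂ :=
  (1/4 : ℂ) * ∑ i : Fin (2*K-1),
    yv K y ((i:ℕ)+1) * yv K y ((i:ℕ)+2) *
      (pY K ⟨(i:ℕ)+1, by have := i.isLt; omega⟩ f y *
         pY K ⟨(i:ℕ)+2, by have := i.isLt; omega⟩ g y
       - pY K ⟨(i:ℕ)+2, by have := i.isLt; omega⟩ f y *
         pY K ⟨(i:ℕ)+1, by have := i.isLt; omega⟩ g y)

/-- `nestList [a₁, …, a_m] = 1 + a₁(1 + a₂(⋯(1 + a_m)⋯))`. -/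
def nestList : List ℂ → ℂ
  | [] => 1
  | a :: t => 1 + a * nestList t

/-- The Stokes parameters `s_n`, `n = 1, …, 2K+2` (paper's 1-based indexing) of the
cluster parametrization:
`s_1 = −y_1^{−2}`;
`s_{2k} = (1+y_{2k}²)·∏_{j=1}^{2k} y_j^{2(−1)^{j+1}}` for `k = 1, …, K`;
`s_{2k+1} = −(1+y_{2k+1}²)·∏_{j=1}^{2k+1} y_j^{2(−1)^{j}}` for `k = 1, …, K−1`;
`s_{2K+1} = −∏_{j=1}^{2K} y_j^{2(−1)^{j}}`;
`s_{2K+2} = y_1²·(1+y_2²(1+y_4²(⋯(1+y_{2K}²)⋯)))·∏_{j=1}^{K} y_{2j}^{−4}`. -/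
def sY (K : ℕ) (n : ℕ) (y : YV K) : ℂ :=
  if n = 1 then -(yv K y 1) ^ (-2 : ℤ)
  else if n = 2*K+1 then -∏ j ∈ range (2*K), (yv K y (j+1)) ^ ((-1:ℤ)^(j+1) * 2)
  else if n = 2*K+2 then
    (yv K y 1)^2 * nestList (List.ofFn fun k : Fin K => (yv K y (2*(k:ℕ)+2))^2)
      * ∏ j ∈ range K, (yv K y (2*(j+1))) ^ (-4 : ℤ)
  else if n % 2 = 0 then
    (1 + (yv K y n)^2) * ∏ j ∈ range n, (yv K y (j+1)) ^ ((-1:ℤ)^j * 2)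
  else -((1 + (yv K y n)^2) * ∏ j ∈ range n, (yv K y (j+1)) ^ ((-1:ℤ)^(j+1) * 2))

/-- `λ = ∏_{j=1}^K y_{2j}²`. -/
def lamY (K : ℕ) (y : YV K) : ℂ := ∏ j ∈ range K, (yv K y (2*(j+1)))^2

theorem zpn (b : ℂ) : b ^ (-2 : ℤ) = (b^2)⁻¹ ∧ b ^ (-3 : ℤ) = (b^3)⁻¹ ∧ b ^ (-4 : ℤ) = (b^4)⁻¹
    ∧ b ^ (-5 : ℤ) = (b^5)⁻¹ := by
  refine ⟨?_, ?_, ?_, ?_⟩ <;> rw [zpow_neg] <;> norm_cast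

theorem prod_diff {E : Type*} [NormedAddCommGroup E] [NormedSpace ℂ E] (y : E) (g : ℕ → E → ℂ) :
    ∀ (n : ℕ), (∀ k ∈ range n, DifferentiableAt ℂ (g k) y) →
      DifferentiableAt ℂ (fun x => ∏ k ∈ range n, g k x) y := by
  intro n
  induction n with
  | zero => intro _; simp
  | succ n ih =>
    intro hg
    simp only [Finset.prod_range_succ]
    exact (ih fun k hk => hg k (by simp at hk ⊢; omega)).mul (hg n (by simp))

theorem nest_diff {E : Type*} [NormedAddCommGroup E] [NormedSpace ℂ E] (y : E) :
    ∀ (n : ℕ) (g : Fin n → E → ℂ), (∀ k, DifferentiableAt ℂ (g k) y) →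
      DifferentiableAt ℂ (fun x => nestList (List.ofFn fun k => g k x)) y := by
  intro n
  induction n with
  | zero => intro g _; simp [nestList]
  | succ n ih =>
    intro g hg
    simp only [List.ofFn_succ, nestList]
    exact ((hg 0).mul (ih (fun k => g k.succ) (fun k => hg _))).const_add 1

theorem yv_diff (K j : ℕ) (y : YV K) : DifferentiableAt ℂ (fun x : YV K => yv K x j) y := by
  unfold yv; fun_prop

theorem yv_update (K j : ℕ) (y : YV K) (i : Fin (2*K+1)) (t : ℂ) (hj : j < 2*K+1) :
    yv K (Function.update y i t) j = if j = i then t else yv K y j := by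
  unfold yv
  have : (⟨j % (2*K+1), Nat.mod_lt _ (by omega)⟩ : Fin (2*K+1)) = ⟨j, hj⟩ := by
    ext; simp [Nat.mod_eq_of_lt hj]
  rw [this, Function.update_apply]
  simp [Fin.ext_iff]

theorem pY_of (K : ℕ) (i : Fin (2*K+1)) (f : YV K → ℂ) (y : YV K) (d : ℂ)
    (hf : DifferentiableAt ℂ f y)
    (h : HasDerivAt (fun t => f (Function.update y i t)) d (y i)) : pY K i f y = d := by
  have h1 : HasFDerivAt f (fderiv ℂ f y) (Function.update y i (y i)) := by
    rw [Function.update_eq_self]; exact hf.hasFDerivAt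
  exact (h1.comp_hasDerivAt (y i) (hasDerivAt_update y i (y i))).unique h

/-- `{s_1, s_{2K+2}}_y = −λ^{−2} + s_1 s_{2K+2}`, identically on `(ℂ*)^{2K}`. -/
theorem cluster_bracket_s1_sLast (K : ℕ) (hK : 1 ≤ K) (y : YV K)
    (hy : ∀ i : Fin (2*K+1), (i:ℕ) ≠ 0 → y i ≠ 0) :
    lcBr K (sY K 1) (sY K (2*K+2)) y
      = -((lamY K y)^2)⁻¹ + sY K 1 y * sY K (2*K+2) y := by
  obtain ⟨m, rfl⟩ : ∃ m, K = m + 1 := ⟨K - 1, by omega⟩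
  have hne : ∀ j, 1 ≤ j → j < 2*(m+1)+1 → yv (m+1) y j ≠ 0 := by
    intro j h1 h2
    unfold yv
    apply hy
    simp only [Nat.mod_eq_of_lt h2]
    omega
  have e1 : sY (m+1) 1 = fun x => -(yv (m+1) x 1) ^ (-2 : ℤ) := by
    funext x; simp [sY]
  have e2 : sY (m+1) (2*(m+1)+2) = fun x =>
      (yv (m+1) x 1)^2 * nestList (List.ofFn fun k : Fin (m+1) => (yv (m+1) x (2*(k:ℕ)+2))^2)
      * ∏ j ∈ range (m+1), (yv (m+1) x (2*(j+1))) ^ (-4 : ℤ) := by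
    funext x
    unfold sY
    rw [if_neg (by omega), if_neg (by omega), if_pos rfl]
  have d1 : DifferentiableAt ℂ (sY (m+1) 1) y := by
    rw [e1]
    exact ((yv_diff _ _ _).zpow (Or.inl (hne 1 le_rfl (by omega)))).neg
  have d2 : DifferentiableAt ℂ (sY (m+1) (2*(m+1)+2)) y := by
    rw [e2]
    refine (((yv_diff _ _ _).pow 2).mul
      (nest_diff y (m+1) (fun k x => (yv (m+1) x (2*(k:ℕ)+2))^2)
        (fun k => (yv_diff _ _ _).pow 2))).mul ?_
    refine prod_diff y (fun j x => (yv (m+1) x (2*(j+1))) ^ (-4 : ℤ)) (m+1) fun j hj => ?_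
    have := Finset.mem_range.1 hj
    exact (yv_diff _ _ _).zpow (Or.inl (hne _ (by omega) (by omega)))
  -- partial derivatives of s_1
  have yi : ∀ j (hj : j < 2*(m+1)+1), y ⟨j, hj⟩ = yv (m+1) y j := by
    intro j hj
    unfold yv
    congr 1
    ext; simp [Nat.mod_eq_of_lt hj]
  have p1 : pY (m+1) ⟨1, by omega⟩ (sY (m+1) 1) y = 2 * (yv (m+1) y 1) ^ (-3 : ℤ) := by
    apply pY_of _ _ _ _ _ d1
    rw [e1, yi]
    simp only [yv_update (m+1) 1 y _ _ (by omega), if_true]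
    have := (hasDerivAt_zpow (-2) (yv (m+1) y 1) (Or.inl (hne 1 le_rfl (by omega)))).neg
    refine this.congr_deriv ?_
    norm_num
  have p1' : ∀ j (hj : j < 2*(m+1)+1), j ≠ 1 → pY (m+1) ⟨j, hj⟩ (sY (m+1) 1) y = 0 := by
    intro j hj hj1
    apply pY_of _ _ _ _ _ d1
    rw [e1]
    simp only [yv_update (m+1) 1 y _ _ (by omega), if_neg (Ne.symm hj1)]
    exact hasDerivAt_const _ _
  -- factor out the y_2 dependence
  set N := nestList (List.ofFn fun k : Fin m => (yv (m+1) y (2*((k:ℕ)+1)+2))^2) with hN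
  set P := ∏ j ∈ range m, (yv (m+1) y (2*(j+1+1))) ^ (-4 : ℤ) with hP
  have v2 : sY (m+1) (2*(m+1)+2) y = (yv (m+1) y 1)^2 * (1 + (yv (m+1) y 2)^2 * N)
      * (P * (yv (m+1) y 2) ^ (-4 : ℤ)) := by
    rw [e2]
    simp only [List.ofFn_succ, nestList, Finset.prod_range_succ', Fin.val_succ, Fin.val_zero]
    rfl
  have p2 : pY (m+1) ⟨2, by omega⟩ (sY (m+1) (2*(m+1)+2)) y
      = (yv (m+1) y 1)^2 * P * (-4 * (yv (m+1) y 2) ^ (-5 : ℤ)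
          - 2 * N * (yv (m+1) y 2) ^ (-3 : ℤ)) := by
    apply pY_of _ _ _ _ _ d2
    rw [yi]
    have hf : (fun t => sY (m+1) (2*(m+1)+2) (Function.update y ⟨2, by omega⟩ t)) = fun t =>
        (yv (m+1) y 1)^2 * (1 + t^2 * N) * (P * t ^ (-4 : ℤ)) := by
      funext t
      rw [e2]
      simp only [List.ofFn_succ, nestList, Finset.prod_range_succ', Fin.val_succ, Fin.val_zero]
      have hl : (fun k : Fin m => (yv (m+1) (Function.update y ⟨2, by omega⟩ t)
          (2*((k:ℕ)+1)+2))^2) = fun k : Fin m => (yv (m+1) y (2*((k:ℕ)+1)+2))^2 := by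
        funext k
        have := k.isLt
        rw [yv_update _ _ _ _ _ (by omega), if_neg (by simp)]
      have hp : ∏ j ∈ range m, (yv (m+1) (Function.update y ⟨2, by omega⟩ t)
          (2*(j+1+1))) ^ (-4 : ℤ) = P := by
        refine Finset.prod_congr rfl fun j hj => ?_
        have := Finset.mem_range.1 hj
        rw [yv_update _ _ _ _ _ (by omega), if_neg (by simp)]
      rw [hl, hp, yv_update _ 1 _ _ _ (by omega), yv_update _ (2*0+2) _ _ _ (by omega)]
      simp [hN]
    rw [hf]
    have h2 := hne 2 (by omega) (by omega)
    have hz := hasDerivAt_zpow (-4) (yv (m+1) y 2) (Or.inl h2)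
    have hq := hasDerivAt_pow 2 (yv (m+1) y 2)
    have := (((hq.mul_const N).const_add 1).const_mul ((yv (m+1) y 1)^2)).mul (hz.const_mul P)
    refine this.congr_deriv ?_
    generalize yv (m+1) y 2 = b at *
    rw [show (-4 - 1 : ℤ) = -5 by norm_num, (zpn b).2.1, (zpn b).2.2.1, (zpn b).2.2.2]
    push_cast
    field_simp
    ring
  have hlam : ((lamY (m+1) y)^2)⁻¹ = P * (yv (m+1) y 2) ^ (-4 : ℤ) := by
    unfold lamY
    rw [Finset.prod_range_succ', mul_pow, mul_inv, hP, ← Finset.prod_pow, ← Finset.prod_inv_distrib]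
    congr 1
    · refine Finset.prod_congr rfl fun j _ => ?_
      rw [← pow_mul, zpow_neg]; norm_cast
    · rw [← pow_mul, zpow_neg]; norm_cast
  have hsum : lcBr (m+1) (sY (m+1) 1) (sY (m+1) (2*(m+1)+2)) y =
      (1/4) * (yv (m+1) y 1 * yv (m+1) y 2 * (pY (m+1) ⟨1, by omega⟩ (sY (m+1) 1) y
        * pY (m+1) ⟨2, by omega⟩ (sY (m+1) (2*(m+1)+2)) y)) := by
    unfold lcBr
    congr 1
    rw [Finset.sum_eq_single (⟨0, by omega⟩ : Fin (2*(m+1)-1))]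
    · simp only [Nat.zero_add]
      rw [p1' 2 _ (by omega)]
      ring
    · intro i _ hi
      have hi0 : (i:ℕ) ≠ 0 := fun h => hi (Fin.ext h)
      rw [p1' _ _ (by omega), p1' _ _ (by omega)]
      ring
    · simp
  rw [hsum, p1, p2, hlam, v2, show sY (m+1) 1 y = -(yv (m+1) y 1) ^ (-2 : ℤ) by rw [e1]]
  have h1 := hne 1 (by omega) (by omega)
  have h2 := hne 2 (by omega) (by omega)
  generalize yv (m+1) y 2 = b at *
  generalize yv (m+1) y 1 = a at *
  rw [(zpn a).1, (zpn a).2.1, (zpn b).2.1, (zpn b).2.2.1, (zpn b).2.2.2]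
  field_simp
  ring
end
end
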